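/- arXiv:2312.16460 — 10 statements merged into one kernel-verified Lean document; each statement's English description precedes it below -/
import Mathlib

section
/- For every real constant C, there exists a natural number n₀ such that for all n ≥ n₀ the following holds: if p, q : Fin n → ℤ satisfy the decodability property, and 0 lies in the range of p and 0 lies in the range of q, then the cardinality of the sumset {p i + q j : i, j ∈ Fin n} is at least C·n. (In other words, |P+Q| = ω(n) for decodable pairs containing 0.) -/
/-- The decodability property for Rook Codes: `p k + q k = p i + q j` iff `i = k` and `j = k`. -/
def Decodable' (n : ℕ) (p q : Fin n → ℤ) : Prop :=
  ∀ i j k : Fin n, p k + q k = p i + q j ↔ (i = k ∧ j = k)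

/-- The sumset `{p i + q j : i, j ∈ Fin n}` as a finset of integers. -/
def sumset (n : ℕ) (p q : Fin n → ℤ) : Finset ℤ :=
  Finset.image (fun ij : Fin n × Fin n => p ij.1 + q ij.2) Finset.univ

open Finset SimpleGraph TripartiteFromTriangles
open scoped Pointwise

namespace Decodable'

variable {n : ℕ} {p q : Fin n → ℤ}

lemma injective_left (h : Decodable' n p q) : Function.Injective p := fun i k hik ↦
  ((h i k k).1 (by rw [hik])).1

lemma injective_right (h : Decodable' n p q) : Function.Injective q := fun j k hjk ↦
  ((h k j k).1 (by rw [hjk])).2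

end Decodable'

variable {n : ℕ}

lemma sumset_eq_add (p q : Fin n → ℤ) : sumset n p q = univ.image p + univ.image q := by
  ext x
  simp [sumset, mem_add]

/-- The triangle with vertices `p k + q i`, `i` and `q k - q i`, indexed by the pair `(i, k)`. -/
def sumDiffTriangle (p q : Fin n → ℤ) (x : Fin n × Fin n) :
    sumset n p q × Fin n × (univ.image q - univ.image q : Finset ℤ) :=
  (⟨p x.2 + q x.1, mem_image.2 ⟨(x.2, x.1), mem_univ _, rfl⟩⟩, x.1,
    ⟨q x.2 - q x.1, sub_mem_sub (mem_image_of_mem _ (mem_univ _))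
      (mem_image_of_mem _ (mem_univ _))⟩)

/-- The triangles `(p k + q i, i, q k - q i)`. For a decodable pair these are edge-disjoint and are
the only triangles in the tripartite graph they span. -/
def sumDiffTriangles (p q : Fin n → ℤ) :
    Finset (sumset n p q × Fin n × (univ.image q - univ.image q : Finset ℤ)) :=
  univ.image (sumDiffTriangle p q)

lemma mem_sumDiffTriangles {p q : Fin n → ℤ} {a : sumset n p q} {b : Fin n}
    {c : (univ.image q - univ.image q : Finset ℤ)} :
    (a, b, c) ∈ sumDiffTriangles p q ↔ ∃ k, p k + q b = a ∧ q k - q b = c := by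
  simp [sumDiffTriangles, sumDiffTriangle, Subtype.ext_iff]

namespace Decodable'

variable {p q : Fin n → ℤ}

lemma explicitDisjoint (h : Decodable' n p q) : ExplicitDisjoint (sumDiffTriangles p q) where
  inj₀ a b c a' h₁ h₂ := by
    obtain ⟨k, hka, hkc⟩ := mem_sumDiffTriangles.1 h₁
    obtain ⟨l, hla, hlc⟩ := mem_sumDiffTriangles.1 h₂
    obtain rfl : k = l := h.injective_right (by linarith)
    exact Subtype.ext (hka.symm.trans hla)
  inj₁ a b c b' h₁ h₂ := by
    obtain ⟨k, hka, hkc⟩ := mem_sumDiffTriangles.1 h₁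
    obtain ⟨l, hla, hlc⟩ := mem_sumDiffTriangles.1 h₂
    obtain rfl : l = k := ((h l l k).1 (by linarith)).1
    exact h.injective_right (by linarith)
  inj₂ a b c c' h₁ h₂ := by
    obtain ⟨k, hka, hkc⟩ := mem_sumDiffTriangles.1 h₁
    obtain ⟨l, hla, hlc⟩ := mem_sumDiffTriangles.1 h₂
    obtain rfl : k = l := h.injective_left (by linarith)
    exact Subtype.ext (hkc.symm.trans hlc)

lemma noAccidental (h : Decodable' n p q) : NoAccidental (sumDiffTriangles p q) where
  eq_or_eq_or_eq a a' b b' c c' h₁ h₂ h₃ := by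
    obtain ⟨j, -, hj⟩ := mem_sumDiffTriangles.1 h₁
    obtain ⟨l, hla, hlc⟩ := mem_sumDiffTriangles.1 h₂
    obtain ⟨k, hk, -⟩ := mem_sumDiffTriangles.1 h₃
    obtain ⟨rfl, rfl⟩ := (h k j l).1 (by linarith)
    exact .inr (.inl (h.injective_right (by linarith)))

lemma card_sumDiffTriangles (h : Decodable' n p q) : #(sumDiffTriangles p q) = n ^ 2 := by
  rw [sumDiffTriangles, card_image_of_injective]
  · simp [sq]
  · rintro ⟨i, k⟩ ⟨j, l⟩ hxy
    simp only [sumDiffTriangle, Prod.mk.injEq] at hxy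
    obtain ⟨hkl, rfl, -⟩ := hxy
    exact Prod.ext rfl (h.injective_left (add_right_cancel (Subtype.ext_iff.1 hkl)))

lemma card_sub_mul_le (h : Decodable' n p q) :
    #(univ.image q - univ.image q) * n ≤ #(sumset n p q) ^ 2 := by
  have := ruzsa_triangle_inequality_sub_add_add (univ.image q) (univ.image p) (univ.image q)
  rwa [card_image_of_injective _ h.injective_left, card_univ, Fintype.card_fin,
    add_comm (univ.image q), ← sumset_eq_add, ← sq] at this

/-- By triangle removal, a decodable pair with sumset of size at most `C * n` has bounded size. -/
lemma triangleRemovalBound_mul_le_one (h : Decodable' n p q) {C : ℝ} (hn : 0 < n)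
    (hC : #(sumset n p q) ≤ C * n) :
    triangleRemovalBound (((C + 1 + C ^ 2) ^ 2)⁻¹) * n ≤ 1 := by
  have hn' : (0 : ℝ) < n := by exact_mod_cast hn
  have hC₀ : 0 ≤ C := nonneg_of_mul_nonneg_left ((Nat.cast_nonneg _).trans hC) hn'
  have hD : (#(univ.image q - univ.image q) : ℝ) ≤ C ^ 2 * n := by
    refine le_of_mul_le_mul_right ?_ hn'
    calc (#(univ.image q - univ.image q) : ℝ) * n ≤ (#(sumset n p q) : ℝ) ^ 2 := by
          exact_mod_cast h.card_sub_mul_le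
      _ ≤ (C * n) ^ 2 := by gcongr
      _ = C ^ 2 * n * n := by ring
  have := h.explicitDisjoint
  have := h.noAccidental
  have hfar : (graph (sumDiffTriangles p q)).FarFromTriangleFree ((C + 1 + C ^ 2) ^ 2)⁻¹ := by
    refine farFromTriangleFree _ ?_
    rw [h.card_sumDiffTriangles, inv_mul_le_iff₀ (by positivity)]
    simp only [Fintype.card_coe, Fintype.card_fin]
    push_cast
    rw [← mul_pow]
    gcongr
    linarith
  have hle := hfar.le_card_cliqueFinset
  rw [card_triangles, h.card_sumDiffTriangles] at hle
  refine le_of_mul_le_mul_right ?_ (pow_pos hn' 2)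
  have hpos := triangleRemovalBound_pos (ε := ((C + 1 + C ^ 2) ^ 2)⁻¹) (by positivity)
  calc triangleRemovalBound ((C + 1 + C ^ 2) ^ 2)⁻¹ * n * n ^ 2
      = triangleRemovalBound ((C + 1 + C ^ 2) ^ 2)⁻¹ * n ^ 3 := by ring
    _ ≤ _ := by
      gcongr
      simp only [Fintype.card_sum, Fintype.card_coe, Fintype.card_fin]
      omega
    _ ≤ ((n ^ 2 : ℕ) : ℝ) := hle
    _ = 1 * (n : ℝ) ^ 2 := by simp

end Decodable'

/-- For decodable pairs containing 0, `|P+Q| = ω(n)`. -/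
theorem stmt0 (C : ℝ) :
    ∃ n₀ : ℕ, ∀ n : ℕ, n₀ ≤ n → ∀ p q : Fin n → ℤ,
      Decodable' n p q → (0 : ℤ) ∈ Set.range p → (0 : ℤ) ∈ Set.range q →
      C * n ≤ ((sumset n p q).card : ℝ) := by
  obtain hC | hC := le_total C 0
  · exact ⟨0, fun n _ p q _ _ _ ↦
      (mul_nonpos_of_nonpos_of_nonneg hC n.cast_nonneg).trans (Nat.cast_nonneg _)⟩
  have hpos := triangleRemovalBound_pos (ε := ((C + 1 + C ^ 2) ^ 2)⁻¹) (by positivity)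
  obtain ⟨m, hm⟩ := exists_nat_gt (triangleRemovalBound ((C + 1 + C ^ 2) ^ 2)⁻¹)⁻¹
  refine ⟨m + 1, fun n hn p q h _ _ ↦ ?_⟩
  by_contra! hlt
  have hmn : (m : ℝ) ≤ n := by exact_mod_cast (Nat.le_succ m).trans hn
  have hle := h.triangleRemovalBound_mul_le_one (by omega) hlt.le
  exact (hm.trans_le hmn).not_ge ((le_inv_mul_iff₀ hpos).2 hle |>.trans_eq (mul_one _))
end

section
/- Let P and Q be nonempty finite sets of integers with |P| = |Q| = n, and let K be a real number such that |P + Q| ≤ K·n. Then |P + Q − P − Q| ≤ K⁷·n. -/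
open Pointwise

/-- The Plünnecke–Ruzsa bound `|B + B - B| ≤ K³ |A|` for `|A + B| ≤ K |A|`, over the reals. -/
theorem card_add_self_sub_self_le {G : Type*} [AddCommGroup G] [DecidableEq G]
    {A B : Finset G} {K : ℝ} (hA : A.Nonempty) (hK : ((A + B).card : ℝ) ≤ K * A.card) :
    ((B - B + B).card : ℝ) ≤ K ^ 3 * A.card := by
  have hpos : (0 : ℝ) < A.card := by exact_mod_cast hA.card_pos
  have h := Finset.pluennecke_ruzsa_inequality_nsmul_sub_nsmul_add hA B 2 1
  rw [one_nsmul, two_nsmul, add_sub_right_comm] at h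
  have h' : ((B - B + B).card : ℝ) ≤ ((A + B).card / A.card : ℝ) ^ (2 + 1) * A.card := by
    have := (NNRat.cast_le (K := ℝ)).2 h
    push_cast at this
    exact this
  refine h'.trans ?_
  gcongr
  exact (div_le_iff₀ hpos).2 hK

/-- Plünnecke–Ruzsa-type bound: if `|P + Q| ≤ K·n` then `|P + Q - P - Q| ≤ K⁷·n`. -/
theorem stmt2 (P Q : Finset ℤ) (n : ℕ) (K : ℝ)
    (hP : P.Nonempty) (hQ : Q.Nonempty)
    (hPcard : P.card = n) (hQcard : Q.card = n)
    (hK : ((P + Q).card : ℝ) ≤ K * n) :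
    (((P + Q - P - Q).card : ℝ)) ≤ K ^ 7 * n := by
  have hn : (0 : ℝ) < n := by exact_mod_cast hPcard ▸ hP.card_pos
  have hK0 : 0 ≤ K := nonneg_of_mul_nonneg_left ((Nat.cast_nonneg _).trans hK) hn
  have hQ3 : ((Q - Q + Q).card : ℝ) ≤ K ^ 3 * n := by
    simpa only [hPcard] using card_add_self_sub_self_le hP (by rwa [hPcard])
  have hP3 : ((P - P + P).card : ℝ) ≤ K ^ 3 * n := by
    simpa only [hQcard] using card_add_self_sub_self_le hQ (by rwa [hQcard, add_comm])
  have hPQ : ((P - P + Q).card : ℝ) * n ≤ (P - P + P).card * (P + Q).card := by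
    exact_mod_cast hPcard ▸ Finset.ruzsa_triangle_inequality_add_add_add (P - P) P Q
  have hPQ4 : ((P - P + Q).card : ℝ) ≤ K ^ 4 * n := by
    refine le_of_mul_le_mul_right ?_ hn
    calc ((P - P + Q).card : ℝ) * n ≤ (P - P + P).card * (P + Q).card := hPQ
      _ ≤ (K ^ 3 * n) * (K * n) := by gcongr
      _ = K ^ 4 * n * n := by ring
  have hsum : ((P - P + (Q - Q)).card : ℝ) * n ≤ (P - P + Q).card * (Q - Q + Q).card := by
    rw [add_comm (Q - Q) Q]
    exact_mod_cast hQcard ▸ Finset.ruzsa_triangle_inequality_add_add_add (P - P) Q (Q - Q)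
  have hset : P + Q - P - Q = P - P + (Q - Q) := by
    rw [add_sub_right_comm, add_sub_assoc]
  rw [hset]
  refine le_of_mul_le_mul_right ?_ hn
  calc ((P - P + (Q - Q)).card : ℝ) * n ≤ (P - P + Q).card * (Q - Q + Q).card := hsum
    _ ≤ (K ^ 4 * n) * (K ^ 3 * n) := by gcongr
    _ = K ^ 7 * n * n := by ring
end

section
/- Let P and Q be nonempty finite sets of integers with |P| = |Q| = n, and let K be a real number such that |P + Q| ≤ K·n. Then |P + Q − Q| ≤ K⁴·n. -/
open Pointwise

/-- A nonempty finite set `A` has a nonempty subset minimising the ratio `|X + B| / |X|`. -/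
theorem exists_subset_minimal_expansion {G : Type*} [DecidableEq G] [Add G]
    {A : Finset G} (hA : A.Nonempty) (B : Finset G) :
    ∃ X ⊆ A, X.Nonempty ∧
      ∀ Y ⊆ A, (X + B).card * Y.card ≤ (Y + B).card * X.card := by
  obtain ⟨X, hX, hmin⟩ := Finset.exists_min_image (A.powerset.erase ∅)
    (fun C ↦ ((C + B).card / C.card : ℚ))
    ⟨A, Finset.mem_erase_of_ne_of_mem hA.ne_empty (Finset.mem_powerset_self A)⟩
  rw [Finset.mem_erase, Finset.mem_powerset, ← Finset.nonempty_iff_ne_empty] at hX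
  refine ⟨X, hX.2, hX.1, fun Y hY ↦ ?_⟩
  obtain rfl | hYne := Y.eq_empty_or_nonempty
  · simp
  have hle := hmin Y
    (Finset.mem_erase_of_ne_of_mem hYne.ne_empty (Finset.mem_powerset.2 hY))
  have hXpos : (0 : ℚ) < X.card := by exact_mod_cast hX.1.card_pos
  have hYpos : (0 : ℚ) < Y.card := by exact_mod_cast hYne.card_pos
  rw [div_le_div_iff₀ hXpos hYpos] at hle
  exact_mod_cast hle

/-- A doubling bound for `P` relative to `Q`: if `|Q + P| ≤ K|Q|` then `|P + P| ≤ K²|Q|`. -/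
theorem card_add_self_le_of_card_add_le {G : Type*} [DecidableEq G] [AddCommGroup G]
    {P Q : Finset G} (hQ : Q.Nonempty) {K : ℝ}
    (hK : ((Q + P).card : ℝ) ≤ K * Q.card) :
    ((P + P).card : ℝ) ≤ K ^ 2 * Q.card := by
  have hQpos : (0 : ℝ) < Q.card := by exact_mod_cast hQ.card_pos
  have hpr : ((P + P).card : ℝ) ≤ ((Q + P).card / Q.card : ℝ) ^ 2 * Q.card := by
    have h := Finset.pluennecke_ruzsa_inequality_nsmul_add hQ P 2
    rw [two_nsmul, ← NNRat.cast_le (K := ℝ)] at h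
    simpa using h
  refine hpr.trans ?_
  gcongr
  exact (div_le_iff₀ hQpos).2 hK

/-- If `|P + Q| ≤ K·n` then `|P + Q - Q| ≤ K⁴·n`. -/
theorem stmt4 (P Q : Finset ℤ) (n : ℕ) (K : ℝ)
    (hP : P.Nonempty) (hQ : Q.Nonempty)
    (hPcard : P.card = n) (hQcard : Q.card = n)
    (hK : ((P + Q).card : ℝ) ≤ K * n) :
    (((P + Q - Q).card : ℝ)) ≤ K ^ 4 * n := by
  have hn : (0 : ℝ) < n := by exact_mod_cast hPcard ▸ hP.card_pos
  have hK0 : 0 ≤ K := nonneg_of_mul_nonneg_left ((Nat.cast_nonneg _).trans hK) hn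
  obtain ⟨X, hXP, hX, hmin⟩ := exists_subset_minimal_expansion hP Q
  have hXpos : (0 : ℝ) < X.card := by exact_mod_cast hX.card_pos
  have hXQ : ((X + Q).card : ℝ) ≤ K * X.card := by
    have h : ((X + Q).card : ℝ) * n ≤ (P + Q).card * X.card := by
      exact_mod_cast hPcard ▸ hmin P Finset.Subset.rfl
    refine le_of_mul_le_mul_right (h.trans ?_) hn
    calc ((P + Q).card : ℝ) * X.card ≤ K * n * X.card := by gcongr
      _ = K * X.card * n := by ring
  have hPX : ((P + X).card : ℝ) ≤ K ^ 2 * n := by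
    have hsub : ((P + X).card : ℝ) ≤ (P + P).card := by
      exact_mod_cast Finset.card_le_card (Finset.add_subset_add_left hXP)
    have hPP := card_add_self_le_of_card_add_le (P := P) (K := K) hQ
      (by rwa [add_comm, hQcard])
    rw [hQcard] at hPP
    exact hsub.trans hPP
  have hPXQ : ((P + X + Q).card : ℝ) ≤ K ^ 3 * n := by
    have h : ((P + X + Q).card : ℝ) * X.card ≤ (X + Q).card * (P + X).card := by
      exact_mod_cast Finset.pluennecke_petridis_inequality_add P
        fun Y hY ↦ hmin Y (hY.trans hXP)
    refine le_of_mul_le_mul_right (h.trans ?_) hXpos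
    calc ((X + Q).card : ℝ) * (P + X).card ≤ (K * X.card) * (K ^ 2 * n) := by gcongr
      _ = K ^ 3 * n * X.card := by ring
  have htri : ((P + Q - Q).card : ℝ) * X.card ≤ (P + X + Q).card * (X + Q).card := by
    have h := Finset.ruzsa_triangle_inequality_sub_add_add (P + Q) X Q
    rw [add_right_comm, add_comm Q X] at h
    exact_mod_cast h
  refine le_of_mul_le_mul_right (htri.trans ?_) hXpos
  calc ((P + X + Q).card : ℝ) * (X + Q).card ≤ (K ^ 3 * n) * (K * X.card) := by gcongr
    _ = K ^ 4 * n * X.card := by ring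
end

section
/- For every real ε > 0 there exists N₀ such that the following holds for all N ≥ N₀: if G is a simple graph on N vertices in which every edge is contained in exactly one triangle, then the number of edges of G is at most ε·N². -/
/-- A graph in which every edge lies in exactly one triangle is locally linear. -/
theorem SimpleGraph.locallyLinear_of_existsUnique_triangle {V : Type*} [Fintype V]
    [DecidableEq V] {G : SimpleGraph V} [DecidableRel G.Adj]
    (h : ∀ u v : V, G.Adj u v →
      ∃! t : Finset V, t ∈ G.cliqueFinset 3 ∧ u ∈ t ∧ v ∈ t) :
    G.LocallyLinear := by
  simp only [SimpleGraph.mem_cliqueFinset_iff] at h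
  refine ⟨fun s hs t ht hst u hu v hv => ?_, fun u v huv => (h u v huv).exists⟩
  by_contra huv
  exact hst ((h u v (hs.isClique hu.1 hv.1 huv)).unique
    ⟨hs, hu.1, hv.1⟩ ⟨ht, hu.2, hv.2⟩)

/-- A locally linear graph on `N` vertices with at least `ε * N ^ 2` edges has
`N` bounded in terms of `ε`. -/
theorem SimpleGraph.LocallyLinear.triangleRemovalBound_mul_card_le_one {V : Type*} [Fintype V]
    [DecidableEq V] [Nonempty V] {G : SimpleGraph V} [DecidableRel G.Adj]
    (hG : G.LocallyLinear) {ε : ℝ}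
    (hε : ε * (Fintype.card V : ℝ) ^ 2 ≤ G.edgeFinset.card) :
    SimpleGraph.triangleRemovalBound (ε / 3) * Fintype.card V ≤ 1 := by
  have hcard : (G.edgeFinset.card : ℝ) = 3 * (G.cliqueFinset 3).card := by
    exact_mod_cast hG.card_edgeFinset
  have hfar : G.FarFromTriangleFree (ε / 3) :=
    hG.edgeDisjointTriangles.farFromTriangleFree (by push_cast; linarith)
  have hedges : (G.edgeFinset.card : ℝ) ≤ (Fintype.card V : ℝ) ^ 2 := by
    exact_mod_cast G.card_edgeFinset_le_card_choose_two.trans (Nat.choose_le_pow _ _)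
  have hpos : (0 : ℝ) < (Fintype.card V : ℝ) ^ 2 := by positivity
  refine le_of_mul_le_mul_right ?_ hpos
  calc SimpleGraph.triangleRemovalBound (ε / 3) * Fintype.card V * (Fintype.card V : ℝ) ^ 2
      = SimpleGraph.triangleRemovalBound (ε / 3) * (Fintype.card V : ℝ) ^ 3 := by ring
    _ ≤ ((G.cliqueFinset 3).card : ℝ) := hfar.le_card_cliqueFinset
    _ ≤ (G.edgeFinset.card : ℝ) := by
      rw [hcard]; linarith [(G.cliqueFinset 3).card.cast_nonneg (α := ℝ)]
    _ ≤ 1 * (Fintype.card V : ℝ) ^ 2 := by rwa [one_mul]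

/-- Corollary of the triangle removal lemma: for every `ε > 0` there is `N₀` such that any
simple graph on `N ≥ N₀` vertices in which every edge lies in exactly one triangle has at
most `ε·N²` edges. -/
theorem stmt6 (ε : ℝ) (hε : 0 < ε) :
    ∃ N₀ : ℕ, ∀ (V : Type) [Fintype V] [DecidableEq V]
      (G : SimpleGraph V) [DecidableRel G.Adj],
      N₀ ≤ Fintype.card V →
      (∀ u v : V, G.Adj u v →
        ∃! t : Finset V, t ∈ G.cliqueFinset 3 ∧ u ∈ t ∧ v ∈ t) →
      (G.edgeFinset.card : ℝ) ≤ ε * (Fintype.card V : ℝ) ^ 2 := by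
  have hbound := SimpleGraph.triangleRemovalBound_pos (show 0 < ε / 3 by positivity)
  obtain ⟨n, hn⟩ := exists_nat_gt (1 / SimpleGraph.triangleRemovalBound (ε / 3))
  refine ⟨n, fun V _ _ G _ hV hG => ?_⟩
  have hlt : 1 / SimpleGraph.triangleRemovalBound (ε / 3) < Fintype.card V :=
    hn.trans_le (by exact_mod_cast hV)
  have : Nonempty V := by
    rw [← Fintype.card_pos_iff]
    exact_mod_cast (one_div_pos.2 hbound).trans hlt
  by_contra! hedges
  have hle := (SimpleGraph.locallyLinear_of_existsUnique_triangle
    hG).triangleRemovalBound_mul_card_le_one hedges.le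
  rw [div_lt_iff₀ hbound] at hlt
  linarith
end

section
/- There exists a constant c > 0 such that for every n ≥ 1 there exist functions p, q : Fin n → ℤ satisfying the decodability property whose sumset {p i + q j : i, j ∈ Fin n} has cardinality at most n·exp(c·√(log n)). (Hence Rook Codes achieve recovery threshold n^{1+o(1)}.) -/
/-- Enumerating a `ThreeAPFree` subset of `{0, …, N - 1}` by both `p` and `q` gives a decodable pair
whose sumset lies in `{0, …, 2 * N - 1}`. -/
theorem exists_decodable_of_le_rothNumberNat {n N : ℕ} (h : n ≤ rothNumberNat N) :
    ∃ p q : Fin n → ℤ, Decodable' n p q ∧ (sumset n p q).card ≤ 2 * N := by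
  obtain ⟨t, htN, htcard, htfree⟩ := rothNumberNat_spec N
  obtain ⟨u, hut, hucard⟩ := Finset.exists_subset_card_eq (h.trans_eq htcard.symm)
  have hu (i : Fin n) : u.orderEmbOfFin hucard i ∈ u := Finset.orderEmbOfFin_mem u hucard i
  have hinj := (u.orderEmbOfFin hucard).injective
  have hfree : ThreeAPFree (u : Set ℕ) := htfree.mono (Finset.coe_subset.2 hut)
  generalize (u.orderEmbOfFin hucard : Fin n → ℕ) = a at hu hinj
  refine ⟨fun i => a i, fun i => a i, fun i j k => ⟨fun hk => ?_, ?_⟩, ?_⟩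
  · have hsum : a i + a j = a k + a k := by
      dsimp only at hk
      omega
    have hik : a i = a k := hfree (hu i) (hu k) (hu j) hsum
    exact ⟨hinj hik, hinj (by omega)⟩
  · rintro ⟨rfl, rfl⟩
    rfl
  · have hsub : sumset n (fun i => (a i : ℤ)) (fun i => (a i : ℤ)) ⊆
        (Finset.range (2 * N)).image (fun m : ℕ => (m : ℤ)) := by
      intro x hx
      obtain ⟨⟨i, j⟩, -, rfl⟩ := Finset.mem_image.1 hx
      have hi := Finset.mem_range.1 (htN (hut (hu i)))
      have hj := Finset.mem_range.1 (htN (hut (hu j)))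
      exact Finset.mem_image.2 ⟨a i + a j, Finset.mem_range.2 (by omega), by push_cast; rfl⟩
    calc _ ≤ _ := Finset.card_le_card hsub
      _ ≤ _ := Finset.card_image_le
      _ = 2 * N := Finset.card_range _

/-- Behrend's bound, inverted: a set of integers without three-term progressions of size `n ≥ 2`
fits into an interval of length `2 * n * exp (40 * √(log n))`. -/
theorem exists_le_rothNumberNat {n : ℕ} (hn : 2 ≤ n) :
    ∃ N : ℕ, n ≤ rothNumberNat N ∧
      (N : ℝ) ≤ 2 * (n * Real.exp (40 * Real.sqrt (Real.log n))) := by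
  have hn2 : (2 : ℝ) ≤ n := by exact_mod_cast hn
  have hn0 : (0 : ℝ) < n := by linarith
  have hlog : 0.69 ≤ Real.log n :=
    (by linarith [Real.log_two_gt_d9] : 0.69 ≤ Real.log 2).trans
      (Real.log_le_log (by norm_num) hn2)
  set s := Real.sqrt (Real.log n) with hs
  have hs2 : s ^ 2 = Real.log n := Real.sq_sqrt (by linarith)
  have hs_half : 1 / 2 ≤ s := Real.le_sqrt_of_sq_le (by linarith)
  have hx : (1 : ℝ) ≤ n * Real.exp (40 * s) :=
    one_le_mul_of_one_le_of_one_le (by linarith) (Real.one_le_exp (by linarith))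
  set N := ⌈(n : ℝ) * Real.exp (40 * s)⌉₊
  have hNge : (n : ℝ) * Real.exp (40 * s) ≤ N := Nat.le_ceil _
  have hN0 : (0 : ℝ) < N := by linarith
  refine ⟨N, ?_, ?_⟩
  · have hlogN : s ^ 2 + 40 * s ≤ Real.log N := by
      rw [hs2, ← Real.log_exp (40 * s), ← Real.log_mul hn0.ne' (Real.exp_pos _).ne']
      exact Real.log_le_log (by linarith) hNge
    have hst : s + 4 ≤ Real.sqrt (Real.log N) := Real.le_sqrt_of_sq_le (by nlinarith)
    have ht2 : Real.sqrt (Real.log N) ^ 2 = Real.log N := Real.sq_sqrt (by nlinarith)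
    have hle : (n : ℝ) ≤ N * Real.exp (-4 * Real.sqrt (Real.log N)) := by
      rw [← Real.exp_log hn0, ← hs2]
      nth_rw 1 [← Real.exp_log hN0]
      rw [← Real.exp_add, Real.exp_le_exp]
      nlinarith
    exact_mod_cast hle.trans Behrend.roth_lower_bound
  · have := Nat.ceil_lt_add_one (zero_le_one.trans hx)
    linarith

/-- Rook Codes achieve recovery threshold `n·e^{O(√(log n))} = n^{1+o(1)}`. -/
theorem stmt7 :
    ∃ c : ℝ, 0 < c ∧ ∀ n : ℕ, 1 ≤ n →
      ∃ p q : Fin n → ℤ, Decodable' n p q ∧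
        ((sumset n p q).card : ℝ) ≤ n * Real.exp (c * Real.sqrt (Real.log n)) := by
  refine ⟨44, by norm_num, fun n hn => ?_⟩
  obtain rfl | hn2 : n = 1 ∨ 2 ≤ n := by omega
  · refine ⟨0, 0, fun i j k => by simp [Subsingleton.elim i k, Subsingleton.elim j k], ?_⟩
    have hcard : (sumset 1 0 0).card ≤ 1 := Finset.card_image_le
    simpa using hcard
  obtain ⟨N, hroth, hN⟩ := exists_le_rothNumberNat hn2
  obtain ⟨p, q, hdec, hcard⟩ := exists_decodable_of_le_rothNumberNat hroth
  refine ⟨p, q, hdec, ?_⟩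
  have hcard' : ((sumset n p q).card : ℝ) ≤ 2 * N := by exact_mod_cast hcard
  have hlog : 0.69 ≤ Real.log n :=
    (by linarith [Real.log_two_gt_d9] : 0.69 ≤ Real.log 2).trans
      (Real.log_le_log (by norm_num) (by exact_mod_cast hn2))
  have hs_half : 1 / 2 ≤ Real.sqrt (Real.log n) := Real.le_sqrt_of_sq_le (by linarith)
  have hfour : 4 ≤ Real.exp (4 * Real.sqrt (Real.log n)) := by
    have h4 : (4 : ℝ) = Real.exp (2 * Real.log 2) := by
      rw [two_mul, Real.exp_add, Real.exp_log two_pos]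
      norm_num
    exact h4.trans_le (Real.exp_le_exp.2 (by linarith [Real.log_two_lt_d9]))
  calc ((sumset n p q).card : ℝ)
      ≤ n * (4 * Real.exp (40 * Real.sqrt (Real.log n))) := by linarith
    _ ≤ n * (Real.exp (4 * Real.sqrt (Real.log n)) * Real.exp (40 * Real.sqrt (Real.log n))) := by
        gcongr
    _ = n * Real.exp (44 * Real.sqrt (Real.log n)) := by
        rw [← Real.exp_add]
        ring_nf
end

section
/- There exists a constant c > 0 such that for every n ≥ 1 there exists a finite set A of natural numbers with |A| = n that is 3-AP-free and satisfies |A + A| ≤ n·exp(c·√(log n)). -/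
open Pointwise

/-- The inequality `n ≤ N exp(-4 √(log N))` holds as soon as `N ≥ exp((√(log n) + 4)²)`. -/
lemma le_mul_exp_neg_four_mul_sqrt_log {n N : ℕ} (hn : 1 ≤ n)
    (hN : Real.exp ((√(Real.log n) + 4) ^ 2) ≤ N) :
    (n : ℝ) ≤ N * Real.exp (-4 * √(Real.log N)) := by
  have hn0 : (0 : ℝ) < n := by exact_mod_cast hn
  have hN0 : (0 : ℝ) < N := (Real.exp_pos _).trans_le hN
  have hlogn : 0 ≤ Real.log n := Real.log_natCast_nonneg n
  have hs : 0 ≤ √(Real.log n) := Real.sqrt_nonneg _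
  have hs2 : √(Real.log n) ^ 2 = Real.log n := Real.sq_sqrt hlogn
  have hlogN : (√(Real.log n) + 4) ^ 2 ≤ Real.log N := (Real.le_log_iff_exp_le hN0).2 hN
  have ht : √(Real.log n) + 4 ≤ √(Real.log N) := Real.le_sqrt_of_sq_le hlogN
  have ht2 : √(Real.log N) ^ 2 = Real.log N := Real.sq_sqrt (Real.log_natCast_nonneg N)
  rw [← Real.exp_log hn0]
  nth_rw 1 [← Real.exp_log hN0]
  rw [← Real.exp_add, Real.exp_le_exp]
  nlinarith

/-- A 3-AP-free set of any prescribed size not exceeding the Roth number of `N` has at most `2N`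
pairwise sums. -/
lemma exists_threeAPFree_card_eq_card_add_self_le {n N : ℕ} (h : n ≤ rothNumberNat N) :
    ∃ A : Finset ℕ, A.card = n ∧ ThreeAPFree (A : Set ℕ) ∧ (A + A).card ≤ 2 * N := by
  obtain ⟨t, ht, hcard, hfree⟩ := rothNumberNat_spec N
  obtain ⟨A, hAt, hA⟩ := Finset.exists_subset_card_eq (hcard ▸ h)
  refine ⟨A, hA, hfree.mono (Finset.coe_subset.2 hAt), ?_⟩
  have hsub : A + A ⊆ Finset.range (2 * N) := by
    intro x hx
    obtain ⟨a, ha, b, hb, rfl⟩ := Finset.mem_add.1 hx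
    have := Finset.mem_range.1 (ht (hAt ha))
    have := Finset.mem_range.1 (ht (hAt hb))
    exact Finset.mem_range.2 (by omega)
  simpa using Finset.card_le_card hsub

/-- There is a 3-AP-free set `A` of `n` natural numbers with `|A + A| ≤ n·e^{c√(log n)}`. -/
theorem stmt8 :
    ∃ c : ℝ, 0 < c ∧ ∀ n : ℕ, 1 ≤ n →
      ∃ A : Finset ℕ, A.card = n ∧
        (∀ a ∈ A, ∀ b ∈ A, ∀ c' ∈ A, a + c' = b + b → a = b) ∧
        ((A + A).card : ℝ) ≤ n * Real.exp (c * Real.sqrt (Real.log n)) := by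
  refine ⟨30, by norm_num, fun n hn => ?_⟩
  obtain rfl | hn2 := hn.eq_or_lt
  · exact ⟨{0}, by simp⟩
  have hn0 : (0 : ℝ) < n := by exact_mod_cast hn
  have hlog : Real.log 2 ≤ Real.log n := Real.log_le_log (by norm_num) (by exact_mod_cast hn2)
  have hlog2 := Real.log_two_gt_d9
  have hs : 0.8 ≤ √(Real.log n) := Real.le_sqrt_of_sq_le (by norm_num; linarith)
  have hs2 : √(Real.log n) ^ 2 = Real.log n := Real.sq_sqrt (by linarith)
  have hceil := Nat.le_ceil (Real.exp ((√(Real.log n) + 4) ^ 2))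
  have hceil' := Nat.ceil_lt_add_one (Real.exp_pos ((√(Real.log n) + 4) ^ 2)).le
  obtain ⟨A, hA, hfree, hsum⟩ := exists_threeAPFree_card_eq_card_add_self_le (by
    exact_mod_cast (le_mul_exp_neg_four_mul_sqrt_log hn hceil).trans Behrend.roth_lower_bound)
  refine ⟨A, hA, fun a ha b hb c hc h => hfree ha hb hc h, ?_⟩
  have hone : 1 ≤ Real.exp ((√(Real.log n) + 4) ^ 2) := Real.one_le_exp (sq_nonneg _)
  have hfour : (4 : ℝ) = Real.exp (2 * Real.log 2) := by
    rw [two_mul, Real.exp_add, Real.exp_log (by norm_num)]; norm_num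
  calc ((A + A).card : ℝ) ≤ 2 * (⌈Real.exp ((√(Real.log n) + 4) ^ 2)⌉₊ : ℝ) := by
        exact_mod_cast hsum
    _ ≤ 4 * Real.exp ((√(Real.log n) + 4) ^ 2) := by linarith
    _ = Real.exp (2 * Real.log 2 + (√(Real.log n) + 4) ^ 2) := by rw [Real.exp_add, ← hfour]
    _ ≤ Real.exp (Real.log n + 30 * √(Real.log n)) := by
        rw [Real.exp_le_exp]
        linarith [Real.log_two_lt_d9]
    _ = n * Real.exp (30 * √(Real.log n)) := by rw [Real.exp_add, Real.exp_log hn0]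
end

section
/- There exists a constant c > 0 such that for every n ≥ 1 there exists a set A of n distinct positive integers that is 3-AP-free and whose maximum element is at most n·exp(c·√(log n)). -/
/-- If `n ≤ rothNumberNat N`, then some 3-AP-free set of exactly `n` integers lies in `[1, N]`. -/
theorem exists_threeAPFree_pos_of_le_rothNumberNat {n N : ℕ} (h : n ≤ rothNumberNat N) :
    ∃ A : Finset ℕ, A.card = n ∧ (∀ a ∈ A, 0 < a ∧ a ≤ N) ∧ ThreeAPFree (A : Set ℕ) := by
  obtain ⟨t, htN, htc, ht⟩ := rothNumberNat_spec N
  obtain ⟨u, hut, huc⟩ := Finset.exists_subset_card_eq (h.trans_eq htc.symm)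
  refine ⟨u.map (addRightEmbedding 1), by simpa using huc, ?_, ?_⟩
  · intro a ha
    obtain ⟨b, hb, rfl⟩ := Finset.mem_map.1 ha
    have := Finset.mem_range.1 (htN (hut hb))
    simp only [addRightEmbedding_apply]
    omega
  · intro a ha b hb c hc habc
    obtain ⟨a, hau, rfl⟩ := Finset.mem_map.1 ha
    obtain ⟨b, hbu, rfl⟩ := Finset.mem_map.1 hb
    obtain ⟨c, hcu, rfl⟩ := Finset.mem_map.1 hc
    simp only [addRightEmbedding_apply] at habc ⊢
    rw [ht (hut hau) (hut hbu) (hut hcu) (by omega)]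

/-- Behrend's lower bound, inverted: Roth numbers reach `n` by `n * exp (40 * √(log n))`. -/
theorem le_rothNumberNat_floor_mul_exp {n : ℕ} (hn : 2 ≤ n) :
    n ≤ rothNumberNat ⌊(n : ℝ) * Real.exp (40 * √(Real.log n))⌋₊ := by
  have hn' : (2 : ℝ) ≤ n := by exact_mod_cast hn
  have hlog : Real.log 2 ≤ Real.log n := Real.log_le_log (by norm_num) hn'
  have hl2 := Real.log_two_gt_d9
  have hl2' := Real.log_two_lt_d9
  set s := √(Real.log n)
  have hss : s ^ 2 = Real.log n := Real.sq_sqrt (by linarith)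
  have hs2 : Real.log 2 ≤ s := Real.le_sqrt_of_sq_le (by nlinarith)
  set x := (n : ℝ) * Real.exp (40 * s) with hx
  have hx2 : 2 ≤ x := by
    have : 1 ≤ Real.exp (40 * s) := Real.one_le_exp (by linarith)
    nlinarith
  have hlogx : Real.log x = s ^ 2 + 40 * s := by
    rw [hx, Real.log_mul (by positivity) (Real.exp_pos _).ne', Real.log_exp, hss]
  have hNx : (⌊x⌋₊ : ℝ) ≤ x := Nat.floor_le (by linarith)
  have hxN : x / 2 ≤ ⌊x⌋₊ := by linarith [Nat.lt_floor_add_one x]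
  have hsqrt : 4 * √(Real.log ⌊x⌋₊) ≤ 39 * s := by
    have : √(Real.log ⌊x⌋₊) ≤ 39 / 4 * s := by
      refine Real.sqrt_le_iff.2 ⟨by linarith, ?_⟩
      have := Real.log_le_log (by linarith) hNx
      nlinarith
    linarith
  have hexp : (2 : ℝ) ≤ Real.exp s := by
    rwa [← Real.log_le_iff_le_exp (by norm_num)]
  have key : (n : ℝ) ≤ rothNumberNat ⌊x⌋₊ := by
    calc (n : ℝ) = n * (2 / 2) := by ring
      _ ≤ n * (Real.exp s / 2) := by gcongr
      _ = x / 2 * Real.exp (-(39 * s)) := by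
        have : Real.exp s = Real.exp (40 * s) * Real.exp (-(39 * s)) := by
          rw [← Real.exp_add]
          ring_nf
        rw [hx, this]
        ring
      _ ≤ ⌊x⌋₊ * Real.exp (-4 * √(Real.log ⌊x⌋₊)) := by
        gcongr
        linarith
      _ ≤ _ := Behrend.roth_lower_bound
  exact_mod_cast key

/-- Behrend's construction: a 3-AP-free set of `n` distinct positive integers whose
maximum element is at most `n·e^{c√(log n)}`. -/
theorem stmt9 :
    ∃ c : ℝ, 0 < c ∧ ∀ n : ℕ, 1 ≤ n →
      ∃ A : Finset ℕ, A.card = n ∧ (∀ a ∈ A, 0 < a) ∧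
        (∀ a ∈ A, ∀ b ∈ A, ∀ c' ∈ A, a + c' = b + b → a = b) ∧
        (∀ a ∈ A, (a : ℝ) ≤ n * Real.exp (c * Real.sqrt (Real.log n))) := by
  refine ⟨40, by norm_num, fun n hn => ?_⟩
  obtain rfl | hn := hn.eq_or_lt
  · exact ⟨{1}, by simp⟩
  · obtain ⟨A, hcard, hA, hfree⟩ :=
      exists_threeAPFree_pos_of_le_rothNumberNat (le_rothNumberNat_floor_mul_exp hn)
    exact ⟨A, hcard, fun a ha => (hA a ha).1,
      fun a ha b hb c hc h => hfree ha hb hc h,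
      fun a ha => (Nat.le_floor_iff (by positivity)).1 (hA a ha).2⟩
end

section
/- For ℓ ∈ ℕ, let S = { Σ_{i<ℓ} v(i)·3^i : v : Fin ℓ → {0,1} } be the set of natural numbers below 3^ℓ all of whose base-3 digits are 0 or 1. Then S has cardinality 2^ℓ, S is 3-AP-free, and |S + S| ≤ 3^ℓ. -/
open Pointwise

theorem sum_mul_pow_lt_pow {b n : ℕ} {f : Fin n → ℕ} (hf : ∀ i, f i < b) :
    ∑ i, f i * b ^ (i : ℕ) < b ^ n :=
  (finFunctionFinEquiv fun i => (⟨f i, hf i⟩ : Fin b)).isLt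

theorem eq_of_sum_mul_pow_eq {b n : ℕ} {f g : Fin n → ℕ} (hf : ∀ i, f i < b)
    (hg : ∀ i, g i < b) (h : ∑ i, f i * b ^ (i : ℕ) = ∑ i, g i * b ^ (i : ℕ)) : f = g := by
  have key : (fun i => (⟨f i, hf i⟩ : Fin b)) = fun i => ⟨g i, hg i⟩ :=
    finFunctionFinEquiv.injective (Fin.ext h)
  funext i
  exact congrArg Fin.val (congrFun key i)

/-- The set of natural numbers below `3^ℓ` whose base-3 digits are all 0 or 1 has `2^ℓ`
elements, is 3-AP-free, and its sumset with itself has at most `3^ℓ` elements. -/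
theorem stmt12 (ℓ : ℕ)
    (S : Finset ℕ)
    (hS : S = Finset.image
      (fun v : Fin ℓ → Fin 2 => ∑ i : Fin ℓ, (v i : ℕ) * 3 ^ (i : ℕ)) Finset.univ) :
    S.card = 2 ^ ℓ ∧
    (∀ a ∈ S, ∀ b ∈ S, ∀ c ∈ S, a + c = b + b → a = b) ∧
    (S + S).card ≤ 3 ^ ℓ := by
  have digit_lt (v : Fin ℓ → Fin 2) (i : Fin ℓ) : (v i : ℕ) < 3 := by omega
  have add_digit_lt (u v : Fin ℓ → Fin 2) (i : Fin ℓ) : (u i : ℕ) + v i < 3 := by omega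
  subst hS
  refine ⟨?_, ?_, ?_⟩
  · rw [Finset.card_image_of_injective]
    · simp
    · intro u v h
      funext i
      exact Fin.ext (congrFun (eq_of_sum_mul_pow_eq (digit_lt u) (digit_lt v) h) i)
  · simp only [Finset.mem_image, Finset.mem_univ, true_and]
    rintro _ ⟨u, rfl⟩ _ ⟨v, rfl⟩ _ ⟨w, rfl⟩ h
    simp only [← Finset.sum_add_distrib, ← add_mul] at h
    have hdigits := eq_of_sum_mul_pow_eq (add_digit_lt u w) (add_digit_lt v v) h
    refine Finset.sum_congr rfl fun i _ => ?_
    have hi : (u i : ℕ) + w i = v i + v i := congrFun hdigits i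
    rw [show (u i : ℕ) = v i by omega]
  · rw [← Finset.card_range (3 ^ ℓ)]
    refine Finset.card_le_card fun x hx => ?_
    simp only [Finset.mem_add, Finset.mem_image, Finset.mem_univ, true_and] at hx
    obtain ⟨_, ⟨u, rfl⟩, _, ⟨v, rfl⟩, rfl⟩ := hx
    simp only [← Finset.sum_add_distrib, ← add_mul]
    exact Finset.mem_range.2 (sum_mul_pow_lt_pow (add_digit_lt u v))
end

section
/- For every real constant K, there exists n₀ such that every finite set P of integers with |P| ≥ n₀ and |P + P| ≤ K·|P| is not 3-AP-free, i.e., P contains a nontrivial 3-term arithmetic progression. -/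
open Pointwise

open Finset SimpleGraph TripartiteFromTriangles

/-- The triples `(x, x + p, x + 2p)` with `x, p ∈ P`, indexing the explicit triangles of a
tripartite graph on `P`, `P + P` and `3 • P`. -/
def progressionTriangles (P : Finset ℤ) : Finset (P × ↥(P + P) × ↥(3 • P)) :=
  univ.image fun q : P × P ↦
    (q.1, ⟨q.1 + q.2, add_mem_add q.1.2 q.2.2⟩,
      ⟨q.1 + q.2 + q.2, by
        rw [succ_nsmul, two_nsmul]
        exact add_mem_add (add_mem_add q.1.2 q.2.2) q.2.2⟩)

lemma mem_progressionTriangles {P : Finset ℤ} {x : P} {y : ↥(P + P)} {z : ↥(3 • P)} :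
    (x, y, z) ∈ progressionTriangles P ↔
      ∃ p ∈ P, (y : ℤ) = x + p ∧ (z : ℤ) = x + p + p := by
  simp only [progressionTriangles, mem_image, mem_univ, true_and, Prod.exists, Prod.mk.injEq,
    Subtype.ext_iff, Subtype.exists]
  constructor
  · rintro ⟨a, ha, p, hp, h₁, h₂, h₃⟩
    exact ⟨p, hp, by lia, by lia⟩
  · rintro ⟨p, hp, h₁, h₂⟩
    exact ⟨x, x.2, p, hp, rfl, h₁.symm, h₂.symm⟩

lemma card_progressionTriangles (P : Finset ℤ) : #(progressionTriangles P) = #P ^ 2 := by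
  rw [progressionTriangles, card_image_of_injective]
  · simp [sq]
  · rintro ⟨a, p⟩ ⟨b, q⟩ h
    simp only [Prod.mk.injEq, Subtype.ext_iff] at h ⊢
    lia

instance explicitDisjoint_progressionTriangles (P : Finset ℤ) :
    ExplicitDisjoint (progressionTriangles P) := by
  constructor <;> intro _ _ _ _ h h' <;> rw [mem_progressionTriangles] at h h' <;>
    obtain ⟨p, _, _, _⟩ := h <;> obtain ⟨q, _, _, _⟩ := h' <;> ext <;> lia

lemma noAccidental_progressionTriangles {P : Finset ℤ}
    (hP : ∀ a ∈ P, ∀ b ∈ P, ∀ c ∈ P, a + c = 2 * b → a = b ∧ b = c) :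
    NoAccidental (progressionTriangles P) where
  eq_or_eq_or_eq a a' b b' c c' ha hb hc := by
    rw [mem_progressionTriangles] at ha hb hc
    obtain ⟨p, hp, _, _⟩ := ha
    obtain ⟨q, hq, _, _⟩ := hb
    obtain ⟨r, hr, _, _⟩ := hc
    have := hP p hp q hq r hr (by lia)
    left
    ext
    lia

lemma card_three_nsmul_le {P : Finset ℤ} {K : ℝ} (hP : P.Nonempty)
    (hK : (#(P + P) : ℝ) ≤ K * #P) : (#(3 • P) : ℝ) ≤ K ^ 3 * #P := by
  have hpos : (0 : ℝ) < #P := by exact_mod_cast hP.card_pos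
  have h : (#(3 • P) : ℝ) ≤ (#(P + P) / #P : ℝ) ^ 3 * #P := by
    have := NNRat.cast_le (K := ℝ).2 (pluennecke_ruzsa_inequality_nsmul_add hP P 3)
    simpa using this
  refine h.trans ?_
  gcongr
  rwa [div_le_iff₀ hpos]

/-- For every `K`, all sufficiently large finite sets of integers with doubling constant at
most `K` contain a nontrivial 3-term arithmetic progression. -/
theorem stmt13 (K : ℝ) :
    ∃ n₀ : ℕ, ∀ P : Finset ℤ, n₀ ≤ P.card →
      ((P + P).card : ℝ) ≤ K * P.card →
      ∃ a ∈ P, ∃ b ∈ P, ∃ c ∈ P, a + c = 2 * b ∧ ¬(a = b ∧ b = c) := by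
  set C : ℝ := 1 + |K| + |K| ^ 3
  have hC : 0 < C := by positivity
  set δ := triangleRemovalBound (1 / C ^ 2)
  have hδ : 0 < δ := triangleRemovalBound_pos (by positivity)
  refine ⟨⌊δ⁻¹⌋₊ + 1, fun P hcard hK ↦ ?_⟩
  by_contra! hP
  have := noAccidental_progressionTriangles hP
  have hpos : 0 < #P := by lia
  have hpos' : (0 : ℝ) < #P := by exact_mod_cast hpos
  have hsum : (#(P + P) : ℝ) ≤ |K| * #P := hK.trans (by gcongr; exact le_abs_self K)
  have htriple := card_three_nsmul_le (card_pos.1 hpos) hsum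
  have hfar : (graph (progressionTriangles P)).FarFromTriangleFree (1 / C ^ 2) := by
    refine farFromTriangleFree _ ?_
    rw [card_progressionTriangles, one_div_mul_eq_div, div_le_iff₀ (by positivity)]
    simp only [Fintype.card_coe]
    push_cast
    rw [← mul_pow]
    gcongr
    linarith [show (#P : ℝ) * C = #P + |K| * #P + |K| ^ 3 * #P by ring]
  have hcount := hfar.le_card_cliqueFinset
  rw [card_triangles, card_progressionTriangles] at hcount
  have hvert : (#P : ℝ) ≤ Fintype.card (P ⊕ ↥(P + P) ⊕ ↥(3 • P)) := by
    simp
    positivity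
  have hlarge : 1 < δ * #P := by
    rw [Nat.add_one_le_iff, Nat.floor_lt' hpos.ne', inv_lt_iff_one_lt_mul₀' hδ] at hcard
    exact hcard
  push_cast at hcount
  have : δ * (#P : ℝ) ^ 3 ≤ #P ^ 2 :=
    (mul_le_mul_of_nonneg_left (pow_le_pow_left₀ hpos'.le hvert 3) hδ.le).trans hcount
  nlinarith [mul_lt_mul_of_pos_right hlarge (pow_pos hpos' 2)]
end

section
/- Let q be a prime, N a positive natural number with N² < q, and S a finite set of integers with |S| < N such that no element of S is divisible by q. Then there exists a natural number λ with λ < q such that for every x ∈ S, N does not divide (λ·x) mod q, where mod returns the representative in {0, 1, …, q−1}. -/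
/-- For `x` not divisible by the prime `q`, at most `(q - 1) / N` multipliers `0 < l < q` send `x`
to a multiple of `N` modulo `q`. -/
theorem card_filter_dvd_mul_emod_le {q : ℕ} (hq : q.Prime) (N : ℕ) {x : ℤ}
    (hx : ¬ ((q : ℤ) ∣ x)) :
    ((Finset.Ioc 0 (q - 1)).filter fun l : ℕ => (N : ℤ) ∣ ((l : ℤ) * x) % (q : ℤ)).card
      ≤ (q - 1) / N := by
  have hq0 : (0 : ℤ) < q := by exact_mod_cast hq.pos
  have hqp : Prime (q : ℤ) := Nat.prime_iff_prime_int.mp hq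
  rw [← Nat.Ioc_filter_dvd_card_eq_div]
  refine Finset.card_le_card_of_injOn (fun l => (((l : ℤ) * x) % (q : ℤ)).toNat) ?_ ?_
  · intro l hl
    simp only [Finset.coe_filter, Finset.mem_Ioc, Set.mem_ofPred_eq] at hl ⊢
    obtain ⟨⟨hl0, hlq⟩, hdvd⟩ := hl
    have hnonneg := Int.emod_nonneg ((l : ℤ) * x) hq0.ne'
    have hlt := Int.emod_lt_of_pos ((l : ℤ) * x) hq0
    have hne : ((l : ℤ) * x) % (q : ℤ) ≠ 0 := fun h => by
      rcases hqp.dvd_or_dvd (Int.dvd_of_emod_eq_zero h) with h | h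
      · have := Nat.le_of_dvd hl0 (Int.natCast_dvd_natCast.mp h)
        omega
      · exact hx h
    refine ⟨by omega, ?_⟩
    rw [← Int.natCast_dvd_natCast, Int.toNat_of_nonneg hnonneg]
    exact hdvd
  · intro a ha b hb hab
    simp only [Finset.coe_filter, Finset.mem_Ioc, Set.mem_ofPred_eq] at ha hb hab
    have ha' := Int.emod_nonneg ((a : ℤ) * x) hq0.ne'
    have hb' := Int.emod_nonneg ((b : ℤ) * x) hq0.ne'
    have hmod : ((a : ℤ) * x) % (q : ℤ) = ((b : ℤ) * x) % (q : ℤ) := by omega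
    have hdvd : (q : ℤ) ∣ ((a : ℤ) - b) * x := by
      rw [sub_mul]
      exact Int.dvd_of_emod_eq_zero (Int.emod_eq_emod_iff_emod_sub_eq_zero.mp hmod)
    have hsub := (hqp.dvd_or_dvd hdvd).resolve_right hx
    have := Int.eq_zero_of_abs_lt_dvd hsub (by rw [abs_lt]; omega)
    omega

/-- The counting argument for choosing `λ`: if `N² < q` and `S` is a set of fewer than `N`
integers, none divisible by `q`, then some `λ < q` makes `N ∤ (λ·x) mod q` for all `x ∈ S`. -/
theorem stmt15 (q : ℕ) (hq : q.Prime) (N : ℕ) (hN : 0 < N) (hNq : N ^ 2 < q)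
    (S : Finset ℤ) (hScard : S.card < N)
    (hSdvd : ∀ x ∈ S, ¬ ((q : ℤ) ∣ x)) :
    ∃ lam : ℕ, lam < q ∧ ∀ x ∈ S, ¬ ((N : ℤ) ∣ (((lam : ℤ) * x) % (q : ℤ))) := by
  by_contra! hcon
  have hq2 := hq.two_le
  have hcover : Finset.Ioc 0 (q - 1) ⊆ S.biUnion fun x =>
      (Finset.Ioc 0 (q - 1)).filter fun l : ℕ => (N : ℤ) ∣ ((l : ℤ) * x) % (q : ℤ) := by
    intro l hl
    obtain ⟨x, hxS, hx⟩ := hcon l (by have := Finset.mem_Ioc.mp hl; omega)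
    exact Finset.mem_biUnion.mpr ⟨x, hxS, Finset.mem_filter.mpr ⟨hl, hx⟩⟩
  have hcard : q - 1 ≤ S.card * ((q - 1) / N) := by
    simpa using (Finset.card_le_card hcover).trans
      (Finset.card_biUnion_le_card_mul _ _ _
        fun x hx => card_filter_dvd_mul_emod_le hq N (hSdvd x hx))
  have hdiv := Nat.mul_div_le (q - 1) N
  rcases Nat.eq_zero_or_pos ((q - 1) / N) with h | h
  · rw [h] at hcard
    omega
  · have := Nat.mul_lt_mul_of_pos_right hScard h
    omega
end
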